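/- Let G be an infinite commutative group and f, g : G → ℝ bounded functions. The following are equivalent: (a) M̄(f) = M̄(g) for every upper mean M̄ on G; (b) M(f) = M(g) for every full mean M on G; (c) M_*(f−g) = M*(f−g) = 0; (d) f and g are limit-commarginal. -/

import Mathlib

open scoped Pointwise BigOperators
open Filter

/-- A real function on `G` is bounded. -/
def Bounded {G : Type*} (f : G → ℝ) : Prop :=
  ∃ C : ℝ, ∀ x, |f x| ≤ C

/-- An upper mean on the bounded real functions on a commutative group `G`. -/
structure IsUpperMean (G : Type*) [AddCommGroup G] (M : (G → ℝ) → ℝ) : Prop where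
  norming : ∀ c : ℝ, M (fun _ => c) = c
  mono : ∀ f g : G → ℝ, Bounded f → Bounded g → (∀ x, f x ≤ g x) → M f ≤ M g
  homog : ∀ c : ℝ, 0 ≤ c → ∀ f : G → ℝ, Bounded f → M (fun x => c * f x) = c * M f
  restr_add : ∀ f : G → ℝ, Bounded f → ∀ t : G, M (fun x => f x + f (x + t)) = 2 * M f
  subadd : ∀ f g : G → ℝ, Bounded f → Bounded g → M (fun x => f x + g x) ≤ M f + M g

/-- A lower mean on the bounded real functions on a commutative group `G`. -/
structure IsLowerMean (G : Type*) [AddCommGroup G] (M : (G → ℝ) → ℝ) : Prop where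
  norming : ∀ c : ℝ, M (fun _ => c) = c
  mono : ∀ f g : G → ℝ, Bounded f → Bounded g → (∀ x, f x ≤ g x) → M f ≤ M g
  homog : ∀ c : ℝ, 0 ≤ c → ∀ f : G → ℝ, Bounded f → M (fun x => c * f x) = c * M f
  restr_add : ∀ f : G → ℝ, Bounded f → ∀ t : G, M (fun x => f x + f (x + t)) = 2 * M f
  superadd : ∀ f g : G → ℝ, Bounded f → Bounded g → M f + M g ≤ M (fun x => f x + g x)

/-- `f` and `f'` are commarginal: marginals of a bounded `F` supported near the diagonal. -/
def Commarginal {G : Type*} [AddCommGroup G] (f f' : G → ℝ) : Prop :=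
  ∃ (F : G → G → ℝ) (B : Finset G),
    (∃ C : ℝ, ∀ x y, |F x y| ≤ C) ∧
    (∀ x y, F x y ≠ 0 → x - y ∈ B) ∧
    (∀ x, ∑ᶠ y, F x y = f x) ∧
    (∀ y, ∑ᶠ x, F x y = f' y)

/-- Uniform convergence of a sequence of functions. -/
def UnifLim {G : Type*} (g : ℕ → G → ℝ) (f : G → ℝ) : Prop :=
  ∀ ε : ℝ, 0 < ε → ∃ N : ℕ, ∀ n ≥ N, ∀ x, |g n x - f x| < ε

/-- `f` and `f'` are limit-commarginal. -/
def LimitCommarginal {G : Type*} [AddCommGroup G] (f f' : G → ℝ) : Prop :=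
  ∃ g g' : ℕ → G → ℝ, (∀ n, Bounded (g n)) ∧ (∀ n, Bounded (g' n)) ∧
    (∀ n, Commarginal (g n) (g' n)) ∧ UnifLim g f ∧ UnifLim g' f'

/-- `g` is a finite convex combination of translates of `f`. -/
def ConvexCombTranslates {G : Type*} [AddCommGroup G] (f g : G → ℝ) : Prop :=
  ∃ (n : ℕ) (c : Fin n → ℝ) (t : Fin n → G),
    (∀ i, 0 ≤ c i) ∧ (∑ i, c i) = 1 ∧ ∀ x, g x = ∑ i, c i * f (x + t i)

/-- The uppermost mean `M*`. -/
noncomputable def Mstar {G : Type*} [AddCommGroup G] (f : G → ℝ) : ℝ :=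
  sInf {a : ℝ | ∃ g : G → ℝ, ConvexCombTranslates f g ∧ a = sSup (Set.range g)}

/-- The lowest mean `M_*`. -/
noncomputable def Mlowstar {G : Type*} [AddCommGroup G] (f : G → ℝ) : ℝ :=
  sSup {a : ℝ | ∃ g : G → ℝ, ConvexCombTranslates f g ∧ a = sInf (Set.range g)}

/-- The `B`-average `(f|B)(t)` of `f`. -/
noncomputable def avg {G : Type*} [AddCommGroup G] (f : G → ℝ) (B : Finset G) (t : G) : ℝ :=
  (∑ b ∈ B, f (b + t)) / (B.card : ℝ)

/-- The expansion pseudomean `E(f)`. -/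
noncomputable def Epm {G : Type*} [AddCommGroup G] [DecidableEq G] (f : G → ℝ) : ℝ :=
  ⨅ T : {T : Finset G // T.Nonempty}, ⨆ B : {B : Finset G // B.Nonempty},
    (∑ b ∈ B.1, f b) / (((B.1 + T.1).card : ℝ))

/-- A finite nonempty `Y ⊆ G` is a tile: some set `Z` of translates partitions `G`. -/
def IsTile {G : Type*} [AddCommGroup G] (Y : Finset G) : Prop :=
  Y.Nonempty ∧ ∃ Z : Set G, ∀ x : G, ∃! p : Y × Z, (p.1 : G) + (p.2 : G) = x

section Means

variable {G : Type*}

theorem Bounded.add {f g : G → ℝ} (hf : Bounded f) (hg : Bounded g) : Bounded (f + g) :=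
  let ⟨C, hC⟩ := hf
  let ⟨D, hD⟩ := hg
  ⟨C + D, fun x => (abs_add_le _ _).trans (add_le_add (hC x) (hD x))⟩

theorem Bounded.smul {f : G → ℝ} (c : ℝ) (hf : Bounded f) : Bounded (c • f) :=
  let ⟨C, hC⟩ := hf
  ⟨|c| * C, fun x => by
    simpa [abs_mul] using mul_le_mul_of_nonneg_left (hC x) (abs_nonneg c)⟩

theorem Bounded.neg {f : G → ℝ} (hf : Bounded f) : Bounded (-f) := by
  simpa using hf.smul (-1)

theorem Bounded.sub {f g : G → ℝ} (hf : Bounded f) (hg : Bounded g) : Bounded (f - g) := by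
  simpa [sub_eq_add_neg] using hf.add hg.neg

theorem bounded_const (c : ℝ) : Bounded (fun _ : G => c) :=
  ⟨|c|, fun _ => le_rfl⟩

variable [AddCommGroup G]

/-- Translation by `t` as a linear operator on real functions. -/
def translation (t : G) : Module.End ℝ (G → ℝ) :=
  LinearMap.funLeft ℝ ℝ (· + t)

@[simp]
theorem translation_apply (t : G) (f : G → ℝ) (x : G) : translation t f x = f (x + t) := rfl

theorem translation_mul (s t : G) : translation s * translation t = translation (t + s) := by
  ext f x
  simp [add_comm, add_left_comm]

variable (G) in
/-- The averaging operators: convex combinations of translations. -/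
def averages : Set (Module.End ℝ (G → ℝ)) :=
  convexHull ℝ (Set.range translation)

theorem translation_mem_averages (t : G) : translation t ∈ averages G :=
  subset_convexHull ℝ _ ⟨t, rfl⟩

theorem one_mem_averages : (1 : Module.End ℝ (G → ℝ)) ∈ averages G := by
  convert translation_mem_averages (0 : G)
  ext f x
  simp

theorem mul_mem_averages {T U : Module.End ℝ (G → ℝ)} (hT : T ∈ averages G)
    (hU : U ∈ averages G) : T * U ∈ averages G := by
  have translation_mul_mem (t : G) {V : Module.End ℝ (G → ℝ)} (hV : V ∈ averages G) :
      translation t * V ∈ averages G := by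
    refine convexHull_min (t := LinearMap.mulLeft ℝ (translation t) ⁻¹' averages G) ?_
      ((convex_convexHull ℝ _).linear_preimage _) hV
    rintro _ ⟨s, rfl⟩
    simpa [translation_mul] using translation_mem_averages (s + t)
  refine convexHull_min (t := LinearMap.mulRight ℝ U ⁻¹' averages G) ?_
    ((convex_convexHull ℝ _).linear_preimage _) hT
  rintro _ ⟨s, rfl⟩
  exact translation_mul_mem s hU

theorem commute_of_mem_averages {T U : Module.End ℝ (G → ℝ)} (hT : T ∈ averages G)
    (hU : U ∈ averages G) : Commute T U := by
  have convex_commute (V : Module.End ℝ (G → ℝ)) : Convex ℝ {W | Commute W V} := by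
    intro A hA B hB a b _ _ _
    exact (hA.smul_left a).add_left (hB.smul_left b)
  refine convexHull_min (t := {W | Commute W U}) ?_ (convex_commute U) hT
  rintro _ ⟨s, rfl⟩
  refine (convexHull_min (t := {W | Commute W (translation s)}) ?_ (convex_commute _) hU).symm
  rintro _ ⟨t, rfl⟩
  simp only [Set.mem_ofPred_eq, Commute, SemiconjBy, translation_mul, add_comm]

theorem average_le {T : Module.End ℝ (G → ℝ)} (hT : T ∈ averages G) {f : G → ℝ} {a : ℝ}
    (hf : ∀ x, f x ≤ a) (x : G) : T f x ≤ a := by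
  refine convexHull_min (t := {W : Module.End ℝ (G → ℝ) | W f x ≤ a}) ?_ ?_ hT
  · rintro _ ⟨t, rfl⟩
    exact hf _
  · exact (convex_Iic a).linear_preimage
      ((LinearMap.proj (φ := fun _ : G => ℝ) x).comp (LinearMap.applyₗ (R := ℝ) f))

theorem le_average {T : Module.End ℝ (G → ℝ)} (hT : T ∈ averages G) {f : G → ℝ} {a : ℝ}
    (hf : ∀ x, a ≤ f x) (x : G) : a ≤ T f x := by
  have := average_le hT (f := -f) (a := -a) (fun y => neg_le_neg (hf y)) x
  simpa using this

theorem abs_average_le {T : Module.End ℝ (G → ℝ)} (hT : T ∈ averages G) {f : G → ℝ} {a : ℝ}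
    (hf : ∀ x, |f x| ≤ a) (x : G) : |T f x| ≤ a :=
  abs_le.2 ⟨le_average hT (fun y => (abs_le.1 (hf y)).1) x,
    average_le hT (fun y => (abs_le.1 (hf y)).2) x⟩

theorem Bounded.average {T : Module.End ℝ (G → ℝ)} (hT : T ∈ averages G) {f : G → ℝ}
    (hf : Bounded f) : Bounded (T f) :=
  let ⟨C, hC⟩ := hf
  ⟨C, abs_average_le hT hC⟩

theorem convexCombTranslates_iff {f g : G → ℝ} :
    ConvexCombTranslates f g ↔ ∃ T ∈ averages G, T f = g := by
  constructor
  · rintro ⟨n, c, t, hc, hs, hg⟩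
    refine ⟨∑ i, c i • translation (t i), (convex_convexHull ℝ _).sum_mem (fun i _ => hc i) hs
      (fun i _ => translation_mem_averages _), ?_⟩
    ext x
    simp [hg, LinearMap.sum_apply, Finset.sum_apply]
  · rintro ⟨T, hT, rfl⟩
    obtain ⟨ι, _, w, z, hw, hs, hz, rfl⟩ := mem_convexHull_iff_exists_fintype.1 hT
    choose t ht using hz
    let e := (Fintype.equivFin ι).symm
    refine ⟨Fintype.card ι, w ∘ e, t ∘ e, fun i => hw _, ?_, fun x => ?_⟩
    · rw [← hs]
      exact e.sum_comp w
    · simp only [← ht, LinearMap.sum_apply, Finset.sum_apply, LinearMap.smul_apply, Pi.smul_apply,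
        translation_apply, smul_eq_mul, Function.comp_apply]
      exact (e.sum_comp fun i => w i * f (x + t i)).symm

theorem Mstar_le {f : G → ℝ} (hf : Bounded f) {T : Module.End ℝ (G → ℝ)} (hT : T ∈ averages G)
    {a : ℝ} (ha : ∀ x, T f x ≤ a) : Mstar f ≤ a := by
  obtain ⟨C, hC⟩ := hf
  have hbdd : BddBelow {a : ℝ | ∃ g : G → ℝ, ConvexCombTranslates f g ∧ a = sSup (Set.range g)} := by
    refine ⟨-C, ?_⟩
    rintro _ ⟨g, hg, rfl⟩
    obtain ⟨U, hU, rfl⟩ := convexCombTranslates_iff.1 hg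
    refine (abs_le.1 (abs_average_le hU hC 0)).1.trans (le_csSup ⟨C, ?_⟩ ⟨0, rfl⟩)
    rintro _ ⟨x, rfl⟩
    exact (abs_le.1 (abs_average_le hU hC x)).2
  refine (csInf_le hbdd ⟨_, convexCombTranslates_iff.2 ⟨T, hT, rfl⟩, rfl⟩).trans ?_
  refine csSup_le (Set.range_nonempty _) ?_
  rintro _ ⟨x, rfl⟩
  exact ha x

theorem exists_average_le_of_Mstar_lt {f : G → ℝ} (hf : Bounded f) {a : ℝ} (ha : Mstar f < a) :
    ∃ T ∈ averages G, ∀ x, T f x ≤ a := by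
  obtain ⟨C, hC⟩ := hf
  have hne : {a : ℝ | ∃ g : G → ℝ, ConvexCombTranslates f g ∧ a = sSup (Set.range g)}.Nonempty :=
    ⟨_, f, convexCombTranslates_iff.2 ⟨1, one_mem_averages, rfl⟩, rfl⟩
  obtain ⟨_, ⟨g, hg, rfl⟩, hlt⟩ := exists_lt_of_csInf_lt hne ha
  obtain ⟨T, hT, rfl⟩ := convexCombTranslates_iff.1 hg
  refine ⟨T, hT, fun x => (le_csSup ⟨C, ?_⟩ (Set.mem_range_self x)).trans hlt.le⟩
  rintro _ ⟨y, rfl⟩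
  exact (abs_le.1 (abs_average_le hT hC y)).2

theorem Mlowstar_eq_neg_Mstar_neg (f : G → ℝ) : Mlowstar f = -Mstar (-f) := by
  have comb_neg {f g : G → ℝ} (h : ConvexCombTranslates f g) : ConvexCombTranslates (-f) (-g) := by
    obtain ⟨T, hT, rfl⟩ := convexCombTranslates_iff.1 h
    exact convexCombTranslates_iff.2 ⟨T, hT, map_neg T f⟩
  have range_neg (g : G → ℝ) : Set.range (-g) = -Set.range g := by
    ext y
    simp [neg_eq_iff_eq_neg]
  rw [Mstar, Real.sInf_def, neg_neg, Mlowstar]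
  congr 1
  ext a
  simp only [Set.mem_ofPred_eq, Set.mem_neg]
  constructor
  · rintro ⟨g, hg, rfl⟩
    exact ⟨-g, comb_neg hg, by rw [range_neg, Real.sInf_def]; simp⟩
  · rintro ⟨g, hg, ha⟩
    refine ⟨-g, by simpa using comb_neg hg, ?_⟩
    rw [Real.sInf_def, range_neg, neg_neg, ← ha, neg_neg]

theorem Mstar_add_le {f g : G → ℝ} (hf : Bounded f) (hg : Bounded g) :
    Mstar (f + g) ≤ Mstar f + Mstar g := by
  refine le_of_forall_pos_le_add fun ε hε => ?_
  obtain ⟨T, hT, hTf⟩ := exists_average_le_of_Mstar_lt hf (lt_add_of_pos_right _ (half_pos hε))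
  obtain ⟨U, hU, hUg⟩ := exists_average_le_of_Mstar_lt hg (lt_add_of_pos_right _ (half_pos hε))
  refine Mstar_le (hf.add hg) (mul_mem_averages hT hU) fun x => ?_
  have hUTf := average_le hU hTf x
  have hTUg := average_le hT hUg x
  have hcomm : T (U f) = U (T f) := LinearMap.congr_fun (commute_of_mem_averages hT hU) f
  simp only [Module.End.mul_apply, map_add, Pi.add_apply, hcomm]
  linarith

theorem Mstar_smul {f : G → ℝ} (hf : Bounded f) {c : ℝ} (hc : 0 < c) :
    Mstar (c • f) = c * Mstar f := by
  have smul_le {f : G → ℝ} (hf : Bounded f) {c : ℝ} (hc : 0 < c) :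
      Mstar (c • f) ≤ c * Mstar f := by
    refine le_of_forall_pos_le_add fun ε hε => ?_
    obtain ⟨T, hT, hTf⟩ :=
      exists_average_le_of_Mstar_lt hf (lt_add_of_pos_right _ (div_pos hε hc))
    refine Mstar_le (hf.smul c) hT fun x => ?_
    have := mul_le_mul_of_nonneg_left (hTf x) hc.le
    rw [mul_add, mul_div_cancel₀ _ hc.ne'] at this
    simpa using this
  refine le_antisymm (smul_le hf hc) ?_
  have := smul_le (hf.smul c) (inv_pos.2 hc)
  rwa [inv_smul_smul₀ hc.ne', le_inv_mul_iff₀ hc] at this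

theorem Mstar_le_of_le {f : G → ℝ} (hf : Bounded f) {a : ℝ} (ha : ∀ x, f x ≤ a) :
    Mstar f ≤ a :=
  Mstar_le hf one_mem_averages ha

theorem Mstar_const (c : ℝ) : Mstar (fun _ : G => c) = c := by
  refine le_antisymm (Mstar_le_of_le (bounded_const c) fun _ => le_rfl) ?_
  refine le_of_forall_gt_imp_ge_of_dense fun a ha => ?_
  obtain ⟨T, hT, h⟩ := exists_average_le_of_Mstar_lt (bounded_const c) ha
  exact (le_average hT (fun _ => le_rfl) 0).trans (h 0)

/-- The average of `f` over the translates by `j • t`, `0 ≤ j < 2 ^ k`. -/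
noncomputable def dyadicAverage (t : G) : ℕ → Module.End ℝ (G → ℝ)
  | 0 => 1
  | k + 1 => ((1 / 2 : ℝ) • (1 : Module.End ℝ (G → ℝ)) +
      (1 / 2 : ℝ) • translation (2 ^ k • t)) * dyadicAverage t k

theorem dyadicAverage_mem_averages (t : G) (k : ℕ) : dyadicAverage t k ∈ averages G := by
  induction k with
  | zero => exact one_mem_averages
  | succ k ih =>
    refine mul_mem_averages ?_ ih
    exact convex_convexHull ℝ _ one_mem_averages (translation_mem_averages _)
      (by norm_num) (by norm_num) (by norm_num)

theorem dyadicAverage_succ_apply (t : G) (k : ℕ) (f : G → ℝ) (x : G) :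
    dyadicAverage t (k + 1) f x =
      1 / 2 * (dyadicAverage t k f x + dyadicAverage t k f (x + 2 ^ k • t)) := by
  simp [dyadicAverage, mul_add]

theorem dyadicAverage_sub_translation (t : G) (k : ℕ) (f : G → ℝ) (x : G) :
    dyadicAverage t k (f - translation t f) x = (f x - f (x + 2 ^ k • t)) / 2 ^ k := by
  induction k generalizing x with
  | zero => simp [dyadicAverage]
  | succ k ih =>
    rw [dyadicAverage_succ_apply, ih, ih, add_assoc, ← add_smul, ← two_mul, ← pow_succ', pow_succ]
    ring

theorem exists_dyadicAverage_sub_le (t : G) {ε : ℝ} (hε : 0 < ε) :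
    ∃ k, ∀ (f : G → ℝ) (C : ℝ), (∀ x, |f x| ≤ C) →
      ∀ x, |dyadicAverage t k (f - translation t f) x| ≤ ε * C := by
  obtain ⟨k, hk⟩ := exists_pow_lt_of_lt_one (half_pos hε) (by norm_num : (1 / 2 : ℝ) < 1)
  refine ⟨k, fun f C hC x => ?_⟩
  have hC0 : 0 ≤ C := (abs_nonneg _).trans (hC x)
  have hdiff : |f x - f (x + 2 ^ k • t)| ≤ 2 * C := by
    have := abs_sub (f x) (f (x + 2 ^ k • t))
    linarith [hC x, hC (x + 2 ^ k • t)]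
  rw [dyadicAverage_sub_translation, abs_div, abs_of_pos (by positivity : (0 : ℝ) < 2 ^ k),
    div_eq_mul_inv]
  rw [one_div, inv_pow] at hk
  calc _ ≤ 2 * C * (ε / 2) := by gcongr
    _ = ε * C := by ring

theorem IsUpperMean.dyadicAverage {M : (G → ℝ) → ℝ} (hM : IsUpperMean G M) {f : G → ℝ}
    (hf : Bounded f) (t : G) (k : ℕ) : M (dyadicAverage t k f) = M f := by
  induction k with
  | zero => rfl
  | succ k ih =>
    have hb := hf.average (dyadicAverage_mem_averages t k)
    have hsum : Bounded fun x => _root_.dyadicAverage t k f x +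
        _root_.dyadicAverage t k f (x + 2 ^ k • t) :=
      hb.add (hb.average (translation_mem_averages (2 ^ k • t)))
    rw [funext (dyadicAverage_succ_apply t k f), hM.homog _ (by norm_num) _ hsum,
      hM.restr_add _ hb, ih]
    ring

theorem IsUpperMean.exists_almost_invariant_average {M : (G → ℝ) → ℝ} (hM : IsUpperMean G M)
    (s : Finset G) {ε : ℝ} (hε : 0 < ε) :
    ∃ T ∈ averages G, (∀ f, Bounded f → M (T f) = M f) ∧
      ∀ t ∈ s, ∀ (f : G → ℝ) (C : ℝ), (∀ x, |f x| ≤ C) →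
        ∀ x, |T (f - translation t f) x| ≤ ε * C := by
  classical
  induction s using Finset.induction_on with
  | empty => exact ⟨1, one_mem_averages, fun _ _ => rfl, by simp⟩
  | insert t s _ ih =>
    obtain ⟨T, hT, hMT, hTs⟩ := ih
    obtain ⟨k, hk⟩ := exists_dyadicAverage_sub_le t hε
    have hD := dyadicAverage_mem_averages t k
    refine ⟨T * _root_.dyadicAverage t k, mul_mem_averages hT hD, fun f hf => ?_, ?_⟩
    · rw [Module.End.mul_apply, hMT _ (hf.average hD), hM.dyadicAverage hf]
    · intro u hu f C hC
      rcases Finset.mem_insert.1 hu with rfl | hu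
      · exact abs_average_le hT (hk f C hC)
      · rw [(commute_of_mem_averages hT hD).eq]
        exact abs_average_le hD (hTs u hu f C hC)

theorem IsUpperMean.le_Mstar {M : (G → ℝ) → ℝ} (hM : IsUpperMean G M) {f : G → ℝ}
    (hf : Bounded f) : M f ≤ Mstar f := by
  classical
  refine le_of_forall_gt_imp_ge_of_dense fun a ha => ?_
  obtain ⟨U, hU, hUa⟩ := exists_average_le_of_Mstar_lt hf ha
  obtain ⟨n, c, t, hc, hs, hg⟩ := convexCombTranslates_iff.2 ⟨U, hU, Eq.refl (U f)⟩
  obtain ⟨C, hC⟩ := id hf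
  have hC0 : 0 ≤ C := (abs_nonneg _).trans (hC 0)
  refine le_of_forall_pos_le_add fun ε hε => ?_
  have hC1 : 0 < C + 1 := by linarith
  obtain ⟨T, hT, hMT, hTs⟩ :=
    hM.exists_almost_invariant_average (Finset.univ.image t) (div_pos hε hC1)
  have hsub : f - U f = ∑ i, c i • (f - translation (t i) f) := by
    ext x
    simp [hg, mul_sub, Finset.sum_sub_distrib, ← Finset.sum_mul, hs]
  have hbound (x : G) : T (f - U f) x ≤ ε := by
    rw [hsub, map_sum, Finset.sum_apply]
    calc _ ≤ ∑ i, c i * ε := by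
          refine Finset.sum_le_sum fun i _ => ?_
          rw [map_smul, Pi.smul_apply, smul_eq_mul]
          refine mul_le_mul_of_nonneg_left ?_ (hc i)
          refine (le_abs_self _).trans ((hTs (t i) (by simp) f (C + 1)
            (fun x => (hC x).trans (by linarith)) x).trans_eq ?_)
          field_simp
      _ = ε := by rw [← Finset.sum_mul, hs, one_mul]
  rw [← hMT f hf, ← hM.norming (a + ε)]
  refine hM.mono _ _ (hf.average hT) (bounded_const _) fun x => ?_
  have := hbound x
  rw [map_sub, Pi.sub_apply] at this
  linarith [average_le hT hUa x]

variable (G) in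
/-- The space of bounded real functions. -/
def boundedFunctions : Submodule ℝ (G → ℝ) where
  carrier := {f | Bounded f}
  add_mem' := Bounded.add
  zero_mem' := bounded_const 0
  smul_mem' c _ := Bounded.smul c

theorem Mstar_sub_translation_le {f : G → ℝ} (hf : Bounded f) (t : G) :
    Mstar (f - translation t f) ≤ 0 := by
  obtain ⟨C, hC⟩ := id hf
  have hC0 : 0 ≤ C := (abs_nonneg _).trans (hC 0)
  refine le_of_forall_pos_le_add fun ε hε => ?_
  have hC1 : 0 < C + 1 := by linarith
  obtain ⟨k, hk⟩ := exists_dyadicAverage_sub_le t (div_pos hε hC1)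
  refine Mstar_le (hf.sub (hf.average (translation_mem_averages t)))
    (dyadicAverage_mem_averages t k) fun x => ?_
  refine (le_abs_self _).trans ((hk f (C + 1) (fun x => (hC x).trans (by linarith)) x).trans_eq ?_)
  field_simp
  simp

/-- A linear functional dominated by `Mstar` defines a full mean. -/
theorem exists_full_mean_of_linear (L : boundedFunctions G →ₗ[ℝ] ℝ)
    (hL : ∀ f : boundedFunctions G, L f ≤ Mstar f.1) :
    ∃ M : (G → ℝ) → ℝ, IsUpperMean G M ∧ IsLowerMean G M ∧
      ∀ f : boundedFunctions G, M f.1 = L f := by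
  classical
  let M : (G → ℝ) → ℝ := fun f => if h : Bounded f then L ⟨f, h⟩ else 0
  have hM {f : G → ℝ} (h : Bounded f) : M f = L ⟨f, h⟩ := dif_pos h
  have norming (c : ℝ) : M (fun _ => c) = c := by
    have le (c : ℝ) : L ⟨fun _ => c, bounded_const c⟩ ≤ c := (hL _).trans_eq (Mstar_const c)
    have hneg : L ⟨fun _ => -c, bounded_const (-c)⟩ = -L ⟨fun _ => c, bounded_const c⟩ :=
      map_neg L ⟨fun _ => c, bounded_const c⟩
    rw [hM (bounded_const c)]
    linarith [le c, le (-c)]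
  have mono (f g : G → ℝ) (hf : Bounded f) (hg : Bounded g) (h : ∀ x, f x ≤ g x) :
      M f ≤ M g := by
    have : L (⟨f, hf⟩ - ⟨g, hg⟩) ≤ 0 := (hL _).trans
      (Mstar_le_of_le (hf.sub hg) (a := 0) fun x => sub_nonpos.2 (h x))
    have hmap := map_sub L ⟨f, hf⟩ ⟨_, hg⟩
    rw [hM hf, hM hg]
    linarith
  have add (f g : G → ℝ) (hf : Bounded f) (hg : Bounded g) :
      M (fun x => f x + g x) = M f + M g := by
    rw [hM hf, hM hg]
    have hadd : L ⟨f + g, hf.add hg⟩ = L ⟨f, hf⟩ + L ⟨g, hg⟩ := map_add L ⟨f, hf⟩ ⟨g, hg⟩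
    exact (hM (hf.add hg)).trans hadd
  have homog (c : ℝ) (f : G → ℝ) (hf : Bounded f) : M (fun x => c * f x) = c * M f := by
    rw [hM hf]
    have hsmul : L ⟨c • f, hf.smul c⟩ = c * L ⟨f, hf⟩ := map_smul L c ⟨f, hf⟩
    exact (hM (hf.smul c)).trans hsmul
  have trans_le (f : G → ℝ) (hf : Bounded f) (t : G) : M f ≤ M (translation t f) := by
    have ht := hf.average (translation_mem_averages t)
    have : L (⟨f, hf⟩ - ⟨_, ht⟩) ≤ 0 := (hL _).trans (Mstar_sub_translation_le hf t)
    have hmap := map_sub L ⟨f, hf⟩ ⟨_, ht⟩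
    rw [hM hf, hM ht]
    linarith
  have trans (f : G → ℝ) (hf : Bounded f) (t : G) : M (fun x => f (x + t)) = M f := by
    refine le_antisymm ?_ (trans_le f hf t)
    have hinv : translation (-t) (translation t f) = f := by
      ext x
      simp
    exact (trans_le _ (hf.average (translation_mem_averages t)) (-t)).trans_eq (congrArg M hinv)
  have restr_add (f : G → ℝ) (hf : Bounded f) (t : G) :
      M (fun x => f x + f (x + t)) = 2 * M f := by
    have ht := hf.average (translation_mem_averages t)
    rw [two_mul]
    exact (add f _ hf ht).trans (congrArg (M f + ·) (trans f hf t))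
  exact ⟨M, ⟨norming, mono, fun c _ => homog c, restr_add, fun f g hf hg => (add f g hf hg).le⟩,
    ⟨norming, mono, fun c _ => homog c, restr_add, fun f g hf hg => (add f g hf hg).ge⟩,
    fun f => hM f.2⟩

theorem exists_full_mean_eq_Mstar {h : G → ℝ} (hh : Bounded h) :
    ∃ M : (G → ℝ) → ℝ, IsUpperMean G M ∧ IsLowerMean G M ∧ M h = Mstar h := by
  let h' : boundedFunctions G := ⟨h, hh⟩
  have hzero : Mstar (0 : G → ℝ) = 0 := Mstar_const 0
  have smul_le (c : ℝ) : c * Mstar h ≤ Mstar (c • h) := by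
    rcases lt_trichotomy c 0 with hc | rfl | hc
    · have := Mstar_add_le (hh.smul c) (hh.smul (-c))
      rw [← add_smul, add_neg_cancel, zero_smul, hzero, Mstar_smul hh (neg_pos.2 hc)] at this
      linarith
    · simp [hzero]
    · exact (Mstar_smul hh hc).ge
  have hspan : ∀ c : ℝ, c • h' = 0 → c • Mstar h = 0 := by
    intro c hc
    rcases smul_eq_zero.1 hc with rfl | h0
    · simp
    · have : h = 0 := congrArg Subtype.val h0
      simp [this, hzero]
  obtain ⟨L, hext, hle⟩ := exists_extension_of_le_sublinear
    (LinearPMap.mkSpanSingleton' h' (Mstar h) hspan) (fun f => Mstar f.1)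
    (fun c hc f => Mstar_smul f.2 hc) (fun f g => Mstar_add_le f.2 g.2) (by
      rintro ⟨f, hf⟩
      obtain ⟨c, rfl⟩ := Submodule.mem_span_singleton.1 hf
      rw [LinearPMap.mkSpanSingleton'_apply]
      exact smul_le c)
  obtain ⟨M, hu, hl, hML⟩ := exists_full_mean_of_linear L hle
  refine ⟨M, hu, hl, (hML h').trans ?_⟩
  have hmem := Submodule.mem_span_singleton_self (R := ℝ) h'
  exact (hext ⟨h', hmem⟩).trans (LinearPMap.mkSpanSingleton'_apply_self _ _ _ _)

theorem full_mean_add {M : (G → ℝ) → ℝ} (hu : IsUpperMean G M) (hl : IsLowerMean G M)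
    {f g : G → ℝ} (hf : Bounded f) (hg : Bounded g) : M (f + g) = M f + M g :=
  le_antisymm (hu.subadd f g hf hg) (hl.superadd f g hf hg)

theorem full_mean_sub {M : (G → ℝ) → ℝ} (hu : IsUpperMean G M) (hl : IsLowerMean G M)
    {f g : G → ℝ} (hf : Bounded f) (hg : Bounded g) : M (f - g) = M f - M g := by
  have := full_mean_add hu hl (hf.sub hg) hg
  rw [sub_add_cancel] at this
  linarith

theorem Mstar_sub_eq_zero {f g : G → ℝ} (hf : Bounded f) (hg : Bounded g)
    (h : ∀ M : (G → ℝ) → ℝ, IsUpperMean G M → IsLowerMean G M → M f = M g) :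
    Mstar (f - g) = 0 := by
  obtain ⟨M, hu, hl, hM⟩ := exists_full_mean_eq_Mstar (hf.sub hg)
  rw [← hM, full_mean_sub hu hl hf hg, h M hu hl, sub_self]

theorem IsUpperMean.le_of_Mstar_sub_eq_zero {M : (G → ℝ) → ℝ} (hM : IsUpperMean G M)
    {f g : G → ℝ} (hf : Bounded f) (hg : Bounded g) (h : Mstar (f - g) = 0) : M f ≤ M g := by
  have hsub := hM.subadd (f - g) g (hf.sub hg) hg
  have hle := hM.le_Mstar (hf.sub hg)
  have heq : (fun x => (f - g) x + g x) = f := by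
    ext x
    simp
  rw [heq] at hsub
  linarith

theorem full_mean_sum {M : (G → ℝ) → ℝ} (hu : IsUpperMean G M) (hl : IsLowerMean G M)
    {ι : Type*} (s : Finset ι) (f : ι → G → ℝ) (hf : ∀ i, Bounded (f i)) :
    M (∑ i ∈ s, f i) = ∑ i ∈ s, M (f i) := by
  classical
  have hb (s : Finset ι) : Bounded (∑ i ∈ s, f i) :=
    (boundedFunctions G).sum_mem fun i _ => hf i
  induction s using Finset.induction_on with
  | empty => exact hu.norming 0
  | insert i s hi ih =>
    rw [Finset.sum_insert hi, Finset.sum_insert hi, full_mean_add hu hl (hf i) (hb s), ih]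

theorem full_mean_translation {M : (G → ℝ) → ℝ} (hu : IsUpperMean G M) (hl : IsLowerMean G M)
    {f : G → ℝ} (hf : Bounded f) (t : G) : M (translation t f) = M f := by
  have h := full_mean_add hu hl hf (hf.average (translation_mem_averages t))
  have h2 : M (f + translation t f) = 2 * M f := hu.restr_add f hf t
  linarith

theorem Commarginal.full_mean_eq {M : (G → ℝ) → ℝ} (hu : IsUpperMean G M) (hl : IsLowerMean G M)
    {f g : G → ℝ} (h : Commarginal f g) : M f = M g := by
  classical
  obtain ⟨F, B, ⟨C, hC⟩, hB, hrow, hcol⟩ := h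
  let φ : G → G → ℝ := fun b x => F x (x - b)
  have hφ (b : G) : Bounded (φ b) := ⟨C, fun x => hC _ _⟩
  have hf : f = ∑ b ∈ B, φ b := by
    ext x
    rw [Finset.sum_apply, ← hrow x, finsum_eq_sum_of_support_subset (s := B.image (x - ·)),
      Finset.sum_image]
    · exact fun a _ b _ hab => sub_right_injective hab
    · intro y hy
      exact Finset.mem_coe.2 (Finset.mem_image.2 ⟨x - y, hB x y hy, by abel⟩)
  have hg : g = ∑ b ∈ B, translation b (φ b) := by
    ext y
    rw [Finset.sum_apply, ← hcol y, finsum_eq_sum_of_support_subset (s := B.image (y + ·)),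
      Finset.sum_image]
    · simp [φ]
    · exact fun a _ b _ hab => add_right_injective y hab
    · intro x hx
      exact Finset.mem_coe.2 (Finset.mem_image.2 ⟨x - y, hB x y hx, by abel⟩)
  rw [hf, hg, full_mean_sum hu hl _ _ hφ,
    full_mean_sum hu hl _ _ fun b => (hφ b).average (translation_mem_averages b)]
  exact Finset.sum_congr rfl fun b _ => (full_mean_translation hu hl (hφ b) b).symm

theorem IsUpperMean.le_add_of_abs_sub_le {M : (G → ℝ) → ℝ} (hM : IsUpperMean G M)
    {f g : G → ℝ} (hf : Bounded f) (hg : Bounded g) {ε : ℝ} (h : ∀ x, |f x - g x| ≤ ε) :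
    M f ≤ M g + ε := by
  calc M f ≤ M (fun x => g x + ε) :=
        hM.mono _ _ hf (hg.add (bounded_const ε)) fun x => by linarith [(abs_le.1 (h x)).2]
    _ ≤ M g + ε := by
        simpa only [hM.norming] using hM.subadd g (fun _ => ε) hg (bounded_const ε)

theorem LimitCommarginal.full_mean_eq {M : (G → ℝ) → ℝ} (hu : IsUpperMean G M)
    (hl : IsLowerMean G M) {f g : G → ℝ} (hf : Bounded f) (hg : Bounded g)
    (h : LimitCommarginal f g) : M f = M g := by
  obtain ⟨u, v, hub, hvb, huv, hlimu, hlimv⟩ := h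
  refine eq_of_forall_dist_le fun ε hε => ?_
  obtain ⟨m, hm⟩ := hlimu (ε / 2) (half_pos hε)
  obtain ⟨n, hn⟩ := hlimv (ε / 2) (half_pos hε)
  let k := max m n
  have hku (x : G) : |u k x - f x| ≤ ε / 2 := (hm k (le_max_left _ _) x).le
  have hkv (x : G) : |v k x - g x| ≤ ε / 2 := (hn k (le_max_right _ _) x).le
  have h1 := hu.le_add_of_abs_sub_le (hub k) hf hku
  have h2 := hu.le_add_of_abs_sub_le (hvb k) hg hkv
  have h3 := hu.le_add_of_abs_sub_le hf (hub k) fun x => abs_sub_comm (f x) _ ▸ hku x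
  have h4 := hu.le_add_of_abs_sub_le hg (hvb k) fun x => abs_sub_comm (g x) _ ▸ hkv x
  have h5 := (huv k).full_mean_eq hu hl
  rw [Real.dist_eq, abs_le]
  constructor <;> linarith

theorem commarginal_translation {f : G → ℝ} (hf : Bounded f) (t : G) :
    Commarginal f (translation t f) := by
  classical
  obtain ⟨C, hC⟩ := hf
  refine ⟨fun x y => if x - y = t then f x else 0, {t}, ⟨C, fun x y => ?_⟩, fun x y h => ?_,
    fun x => ?_, fun y => ?_⟩
  · dsimp only
    split_ifs
    · exact hC x
    · simpa using (abs_nonneg _).trans (hC x)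
  · rw [Finset.mem_singleton]
    by_contra hne
    exact h (if_neg hne)
  · rw [finsum_eq_single _ (x - t)]
    · simp
    · intro y hy
      exact if_neg fun h => hy (by rw [← h]; abel)
  · rw [finsum_eq_single _ (y + t)]
    · simp
    · intro x hx
      exact if_neg fun h => hx (by rw [← h]; abel)

theorem Commarginal.add {f f' g g' : G → ℝ} (h : Commarginal f f') (h' : Commarginal g g') :
    Commarginal (f + g) (f' + g') := by
  classical
  obtain ⟨F, B, ⟨C, hC⟩, hB, hrow, hcol⟩ := h
  obtain ⟨F', B', ⟨C', hC'⟩, hB', hrow', hcol'⟩ := h'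
  have finite_row {F : G → G → ℝ} {B : Finset G} (hB : ∀ x y, F x y ≠ 0 → x - y ∈ B) (x : G) :
      (Function.support (F x)).Finite :=
    (B.image (x - ·)).finite_toSet.subset fun y hy =>
      Finset.mem_coe.2 (Finset.mem_image.2 ⟨x - y, hB x y hy, by abel⟩)
  have finite_col {F : G → G → ℝ} {B : Finset G} (hB : ∀ x y, F x y ≠ 0 → x - y ∈ B) (y : G) :
      (Function.support fun x => F x y).Finite :=
    (B.image (y + ·)).finite_toSet.subset fun x hx =>
      Finset.mem_coe.2 (Finset.mem_image.2 ⟨x - y, hB x y hx, by abel⟩)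
  refine ⟨F + F', B ∪ B', ⟨C + C', fun x y => (abs_add_le _ _).trans (add_le_add (hC x y) (hC' x y))⟩,
    fun x y h => ?_, fun x => ?_, fun y => ?_⟩
  · by_cases h0 : F x y = 0
    · refine Finset.mem_union_right _ (hB' x y fun h0' => h ?_)
      simp [h0, h0']
    · exact Finset.mem_union_left _ (hB x y h0)
  · simp only [Pi.add_apply]
    rw [finsum_add_distrib (finite_row hB x) (finite_row hB' x), hrow, hrow']
  · simp only [Pi.add_apply]
    rw [finsum_add_distrib (finite_col hB y) (finite_col hB' y), hcol, hcol']

theorem Commarginal.smul {f f' : G → ℝ} (c : ℝ) (h : Commarginal f f') :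
    Commarginal (c • f) (c • f') := by
  obtain ⟨F, B, ⟨C, hC⟩, hB, hrow, hcol⟩ := h
  refine ⟨fun x y => c * F x y, B, ⟨|c| * C, fun x y => ?_⟩,
    fun x y h => hB x y (right_ne_zero_of_mul h), fun x => ?_, fun y => ?_⟩
  · rw [abs_mul]
    exact mul_le_mul_of_nonneg_left (hC x y) (abs_nonneg c)
  · rw [← mul_finsum, hrow, Pi.smul_apply, smul_eq_mul]
  · rw [← mul_finsum, hcol, Pi.smul_apply, smul_eq_mul]

theorem commarginal_average {f : G → ℝ} (hf : Bounded f) {T : Module.End ℝ (G → ℝ)}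
    (hT : T ∈ averages G) : Commarginal f (T f) := by
  refine convexHull_min (t := {W : Module.End ℝ (G → ℝ) | Commarginal f (W f)}) ?_ ?_ hT
  · rintro _ ⟨t, rfl⟩
    exact commarginal_translation hf t
  · intro U hU V hV a b _ _ hab
    have h := (Commarginal.smul a hU).add (Commarginal.smul b hV)
    rwa [← add_smul, hab, one_smul] at h

theorem exists_abs_average_le {h : G → ℝ} (hh : Bounded h) (hup : Mstar h = 0)
    (hlow : Mstar (-h) = 0) {ε : ℝ} (hε : 0 < ε) : ∃ T ∈ averages G, ∀ x, |T h x| ≤ ε := by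
  obtain ⟨T, hT, hTh⟩ := exists_average_le_of_Mstar_lt hh (hup.trans_lt hε)
  obtain ⟨U, hU, hUh⟩ := exists_average_le_of_Mstar_lt hh.neg (hlow.trans_lt hε)
  refine ⟨T * U, mul_mem_averages hT hU, fun x => abs_le.2 ⟨?_, ?_⟩⟩
  · have := average_le hT hUh x
    simp only [map_neg, Pi.neg_apply] at this
    exact neg_le.1 this
  · rw [(commute_of_mem_averages hT hU).eq]
    exact average_le hU hTh x

theorem limitCommarginal_of_Mstar {f g : G → ℝ} (hf : Bounded f) (hg : Bounded g)
    (hup : Mstar (f - g) = 0) (hlow : Mstar (-(f - g)) = 0) : LimitCommarginal f g := by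
  choose T hT hTh using fun n : ℕ =>
    exists_abs_average_le (hf.sub hg) hup hlow (Nat.one_div_pos_of_nat (α := ℝ) (n := n))
  refine ⟨fun _ => f, fun n => T n (f - g) + g, fun _ => hf,
    fun n => ((hf.sub hg).average (hT n)).add hg, fun n => ?_, ?_, ?_⟩
  · have := (commarginal_average (hf.sub hg) (hT n)).add (commarginal_average hg one_mem_averages)
    rwa [sub_add_cancel] at this
  · exact fun ε hε => ⟨0, fun n _ x => by simpa using hε⟩
  · intro ε hε
    obtain ⟨N, hN⟩ := exists_nat_one_div_lt hε
    refine ⟨N, fun n hn x => ?_⟩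
    simp only [Pi.add_apply, add_sub_cancel_right]
    exact (hTh n x).trans_lt ((Nat.one_div_le_one_div hn).trans_lt hN)

end Means

/-- for bounded `f, g` the following are equivalent: equal value under all
upper means; equal value under all full means; `M_*(f−g) = M*(f−g) = 0`; and
limit-commarginality of `f` and `g`. -/
theorem stmt17 {G : Type*} [AddCommGroup G] [Infinite G]
    (f g : G → ℝ) (hf : Bounded f) (hg : Bounded g) :
    ((∀ M : (G → ℝ) → ℝ, IsUpperMean G M → M f = M g) ↔
      (∀ M : (G → ℝ) → ℝ, IsUpperMean G M → IsLowerMean G M → M f = M g)) ∧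
    ((∀ M : (G → ℝ) → ℝ, IsUpperMean G M → M f = M g) ↔
      (Mlowstar (fun x => f x - g x) = 0 ∧ Mstar (fun x => f x - g x) = 0)) ∧
    ((∀ M : (G → ℝ) → ℝ, IsUpperMean G M → M f = M g) ↔
      LimitCommarginal f g) := by
  have hlow : Mlowstar (f - g) = 0 ↔ Mstar (g - f) = 0 := by
    rw [Mlowstar_eq_neg_Mstar_neg, neg_eq_zero, neg_sub]
  have fullMean_to_star
      (h : ∀ M : (G → ℝ) → ℝ, IsUpperMean G M → IsLowerMean G M → M f = M g) :
      Mlowstar (f - g) = 0 ∧ Mstar (f - g) = 0 :=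
    ⟨hlow.2 (Mstar_sub_eq_zero hg hf fun M hu hl => (h M hu hl).symm),
      Mstar_sub_eq_zero hf hg h⟩
  have star_to_upperMean (h : Mlowstar (f - g) = 0 ∧ Mstar (f - g) = 0)
      (M : (G → ℝ) → ℝ) (hM : IsUpperMean G M) : M f = M g :=
    le_antisymm (hM.le_of_Mstar_sub_eq_zero hf hg h.2)
      (hM.le_of_Mstar_sub_eq_zero hg hf (hlow.1 h.1))
  refine ⟨⟨fun h M hu _ => h M hu, fun h => star_to_upperMean (fullMean_to_star h)⟩,
    ⟨fun h => fullMean_to_star fun M hu _ => h M hu, star_to_upperMean⟩,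
    ⟨fun h => ?_, fun h => star_to_upperMean (fullMean_to_star fun M hu hl =>
      h.full_mean_eq hu hl hf hg)⟩⟩
  obtain ⟨h1, h2⟩ := fullMean_to_star fun M hu _ => h M hu
  exact limitCommarginal_of_Mstar hf hg h2 (by rw [neg_sub]; exact hlow.1 h1)
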